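/- Let (W_a, S) be a Coxeter group, Ω a group acting on W_a preserving S, W̃ = W_a ⋊ Ω, and σ an automorphism of W̃ preserving W_a, S, and Ω. Let W^K, W^{K'} be σ-stable standard parabolic subgroups of W_a. Then the natural map from (W̃^σ-double cosets) (W^K)^σ \ W̃^σ / (W^{K'})^σ to the σ-fixed points of W^K \ W̃ / W^{K'} is bijective. -/

import Mathlib

/-- The double coset equivalence relation on `G` attached to two subgroups. -/
def HR.dcSetoid {G : Type*} [Group G] (K K' : Subgroup G) : Setoid G where
  r x y := ∃ k ∈ K, ∃ k' ∈ K', y = k * x * k'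
  iseqv := by
    constructor
    · exact fun x => ⟨1, K.one_mem, 1, K'.one_mem, by group⟩
    · rintro x y ⟨k, hk, k', hk', rfl⟩
      exact ⟨k⁻¹, K.inv_mem hk, k'⁻¹, K'.inv_mem hk', by group⟩
    · rintro x y z ⟨k, hk, k', hk', rfl⟩ ⟨l, hl, l', hl', rfl⟩
      exact ⟨l * k, K.mul_mem hl hk, k' * l', K'.mul_mem hk' hl', by group⟩

/-- The double coset relation on the `σ`-fixed elements, using `σ`-fixed
elements of `K` and `K'`. -/
def HR.dcSetoidFix {G : Type*} [Group G] (σ : G ≃* G) (K K' : Subgroup G) :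
    Setoid {x : G // σ x = x} where
  r x y := ∃ k : G, σ k = k ∧ k ∈ K ∧ ∃ k' : G, σ k' = k' ∧ k' ∈ K' ∧ (y : G) = k * x * k'
  iseqv := by
    constructor
    · exact fun x => ⟨1, by simp, K.one_mem, 1, by simp, K'.one_mem, by group⟩
    · rintro x y ⟨k, hσk, hk, k', hσk', hk', hy⟩
      exact ⟨k⁻¹, by simp [hσk], K.inv_mem hk, k'⁻¹, by simp [hσk'], K'.inv_mem hk',
        by rw [hy]; group⟩
    · rintro x y z ⟨k, hσk, hk, k', hσk', hk', hy⟩ ⟨l, hσl, hl, l', hσl', hl', hz⟩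
      exact ⟨l * k, by simp [hσl, hσk], K.mul_mem hl hk, k' * l',
        by simp [hσk', hσl'], K'.mul_mem hk' hl', by rw [hz, hy]; group⟩

/-- The natural map from fixed double cosets to double cosets. -/
def HR.dcMap {G : Type*} [Group G] (σ : G ≃* G) (K K' : Subgroup G) :
    Quotient (HR.dcSetoidFix σ K K') → Quotient (HR.dcSetoid K K') :=
  Quotient.map' Subtype.val
    (by rintro a b ⟨k, -, hk, k', -, hk', h⟩; exact ⟨k, hk, k', hk', h⟩)

namespace CoxeterSystem

variable {B W : Type*} [Group W] {M : CoxeterMatrix B} (cs : CoxeterSystem M W)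

open scoped Classical in
/-- The generator `s i` acting on pairs `(t, e)`: it conjugates `t` and flips the sign `e`
exactly when `t = s i`. -/
noncomputable def signedConj (i : B) : Function.End (W × ZMod 2) :=
  fun p ↦ (cs.simple i * p.1 * cs.simple i, p.2 + if p.1 = cs.simple i then 1 else 0)

/-- Conjugation by a power of the rotation `s i * s i'` in terms of the reflection `s i'`. -/
theorem pow_conj_eq_simple_mul_pow_iff (i i' : B) (m a : ℕ) (t : W) :
    (cs.simple i * cs.simple i') ^ m * t * ((cs.simple i * cs.simple i') ^ m)⁻¹ =
        cs.simple i' * (cs.simple i * cs.simple i') ^ a ↔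
      t = cs.simple i' * (cs.simple i * cs.simple i') ^ (2 * m + a) := by
  have h : ∀ m : ℕ, (cs.simple i * cs.simple i') ^ m * cs.simple i' *
      (cs.simple i * cs.simple i') ^ m = cs.simple i' := by
    intro m
    induction m with
    | zero => simp
    | succ m ih =>
      rw [pow_succ]
      nth_rw 2 [← pow_succ]
      rw [pow_succ']
      calc _ = (cs.simple i * cs.simple i') ^ m * (cs.simple i * (cs.simple i' * cs.simple i') *
            cs.simple i * cs.simple i') * (cs.simple i * cs.simple i') ^ m := by
            simp only [mul_assoc]
        _ = _ := by simpa using ih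
  rw [mul_inv_eq_iff_eq_mul, ← eq_inv_mul_iff_mul_eq]
  have h' : ((cs.simple i * cs.simple i') ^ m)⁻¹ * cs.simple i' =
      cs.simple i' * (cs.simple i * cs.simple i') ^ m := by
    rw [inv_mul_eq_iff_eq_mul, ← mul_assoc, h]
  rw [mul_assoc, ← mul_assoc, h', mul_assoc, ← pow_add, ← pow_add,
    show m + (a + m) = 2 * m + a by ring]

open scoped Classical in
theorem signedConj_mul_pow_apply (i i' : B) (m : ℕ) (p : W × ZMod 2) :
    ((cs.signedConj i * cs.signedConj i') ^ m) p =
      ((cs.simple i * cs.simple i') ^ m * p.1 * ((cs.simple i * cs.simple i') ^ m)⁻¹,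
        p.2 + ∑ k ∈ Finset.range (2 * m),
          if p.1 = cs.simple i' * (cs.simple i * cs.simple i') ^ k then 1 else 0) := by
  induction m with
  | zero => simp; rfl
  | succ m ih =>
    have hmul : ∀ (f g : Function.End (W × ZMod 2)) q, (f * g) q = f (g q) := fun _ _ _ ↦ rfl
    rw [pow_succ', hmul, ih, hmul]
    set r := cs.simple i * cs.simple i' with hr
    have h0 := cs.pow_conj_eq_simple_mul_pow_iff i i' m 0 p.1
    have h1 := cs.pow_conj_eq_simple_mul_pow_iff i i' m 1 p.1
    rw [← hr] at h0 h1
    rw [pow_zero, mul_one, add_zero] at h0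
    have h2 : ∀ u : W, cs.simple i' * u * cs.simple i' = cs.simple i ↔
        u = cs.simple i' * r ^ 1 := by
      intro u
      rw [pow_one, hr]
      constructor
      · intro h
        rw [← h]
        simp [mul_assoc]
      · rintro rfl
        simp [mul_assoc]
    rw [show 2 * (m + 1) = 2 * m + 1 + 1 by ring, Finset.sum_range_succ, Finset.sum_range_succ]
    simp only [signedConj, h0, h1, h2]
    refine Prod.ext ?_ ?_
    · simp only [pow_succ', mul_inv_rev, hr, cs.inv_simple, mul_assoc]
    · simp only [add_assoc]

theorem isLiftable_signedConj : M.IsLiftable cs.signedConj := by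
  classical
  intro i i'
  funext p
  rw [signedConj_mul_pow_apply, two_mul, Finset.sum_range_add]
  simp only [pow_add, cs.simple_mul_simple_pow, one_mul]
  rw [CharTwo.add_self_eq_zero]
  simp
  rfl

open scoped Classical in
theorem lift_signedConj_wordProd (ω : List B) (p : W × ZMod 2) :
    cs.lift ⟨cs.signedConj, cs.isLiftable_signedConj⟩ (cs.wordProd ω) p =
      (cs.wordProd ω * p.1 * (cs.wordProd ω)⁻¹, p.2 + (cs.rightInvSeq ω).count p.1) := by
  induction ω with
  | nil => simp; rfl
  | cons i ω ih =>
    have hmul : ∀ (f g : Function.End (W × ZMod 2)) q, (f * g) q = f (g q) := fun _ _ _ ↦ rfl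
    rw [wordProd_cons, map_mul, hmul, ih, lift_apply_simple,
      rightInvSeq, List.count_cons]
    have h : cs.wordProd ω * p.1 * (cs.wordProd ω)⁻¹ = cs.simple i ↔
        (cs.wordProd ω)⁻¹ * cs.simple i * cs.wordProd ω = p.1 := by
      constructor
      · intro h
        rw [← h]
        group
      · intro h
        rw [← h]
        group
    refine Prod.ext ?_ ?_
    · simp [signedConj, mul_assoc]
    · simp [signedConj, h, add_assoc]

open scoped Classical in
/-- The parity of the multiplicity of `t` in the right inversion sequence of a word depends only
on the product of the word. -/
theorem count_rightInvSeq_congr {ω ω' : List B} (h : cs.wordProd ω = cs.wordProd ω') (t : W) :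
    ((cs.rightInvSeq ω).count t : ZMod 2) = (cs.rightInvSeq ω').count t := by
  have h₁ := cs.lift_signedConj_wordProd ω (t, 0)
  rw [h, cs.lift_signedConj_wordProd ω' (t, 0)] at h₁
  simpa using (congrArg Prod.snd h₁).symm

theorem isReduced_of_nodup_rightInvSeq {ω : List B} (h : (cs.rightInvSeq ω).Nodup) :
    cs.IsReduced ω := by
  classical
  obtain ⟨ω', hω', hprod⟩ := cs.exists_isReduced (cs.wordProd ω)
  have hsub : cs.rightInvSeq ω ⊆ cs.rightInvSeq ω' := by
    intro t ht
    have hc := cs.count_rightInvSeq_congr hprod t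
    rw [List.count_eq_one_of_mem h ht] at hc
    by_contra hn
    rw [List.count_eq_zero_of_not_mem hn] at hc
    simp at hc
  have hle := (List.subperm_of_subset h hsub).length_le
  rw [length_rightInvSeq, length_rightInvSeq, ← hω'.eq, ← hprod] at hle
  exact le_antisymm (cs.length_wordProd_le ω) hle

/-- The deletion condition. -/
theorem exists_sublist_of_not_isReduced {ω : List B} (h : ¬ cs.IsReduced ω) :
    ∃ ω' : List B, ω'.Sublist ω ∧ ω'.length < ω.length ∧ cs.wordProd ω' = cs.wordProd ω := by
  have hd : ¬ (cs.rightInvSeq ω).Nodup := fun hn ↦ h (cs.isReduced_of_nodup_rightInvSeq hn)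
  rw [List.nodup_iff_getElem?_ne_getElem?] at hd
  push Not at hd
  obtain ⟨j, j', hjj', hj', dup⟩ := hd
  rw [length_rightInvSeq] at hj'
  rw [List.getElem?_eq_getElem (by simp; lia), List.getElem?_eq_getElem (by simp; lia)] at dup
  apply Option.some_injective at dup
  rw [← List.getD_eq_getElem _ 1, ← List.getD_eq_getElem _ 1] at dup
  have herase : (cs.rightInvSeq (ω.eraseIdx j)).getD (j' - 1) 1 =
      (cs.rightInvSeq ω).getD j' 1 := by
    grind only [cs.getD_rightInvSeq, = List.eraseIdx_eq_take_drop_succ, = List.getElem?_eraseIdx,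
      = List.drop_append, List.drop_of_length_le, List.drop_drop, = List.length_append,
      = List.length_take, = List.length_drop, = min_def]
  refine ⟨(ω.eraseIdx j).eraseIdx (j' - 1),
    (List.eraseIdx_sublist _ _).trans (List.eraseIdx_sublist _ _), ?_, ?_⟩
  · have h₁ := (List.eraseIdx_sublist (ω.eraseIdx j) (j' - 1)).length_le
    have h₂ := List.length_eraseIdx_add_one (l := ω) (i := j) (by lia)
    lia
  · rw [← wordProd_mul_getD_rightInvSeq, ← wordProd_mul_getD_rightInvSeq, herase, ← dup, mul_assoc,
      getD_rightInvSeq_mul_self, mul_one]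

theorem exists_isReduced_sublist (ω : List B) :
    ∃ ω' : List B, ω'.Sublist ω ∧ cs.IsReduced ω' ∧ cs.wordProd ω' = cs.wordProd ω := by
  induction hn : ω.length using Nat.strong_induction_on generalizing ω with
  | _ n ih =>
    by_cases h : cs.IsReduced ω
    · exact ⟨ω, List.Sublist.refl _, h, rfl⟩
    · obtain ⟨ω₁, hsub, hlt, hprod⟩ := cs.exists_sublist_of_not_isReduced h
      obtain ⟨ω₂, hsub', hred, hprod'⟩ := ih _ (hn ▸ hlt) ω₁ rfl
      exact ⟨ω₂, hsub'.trans hsub, hred, hprod'.trans hprod⟩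

theorem mem_closure_simple_image_iff (J : Set B) (w : W) :
    w ∈ Subgroup.closure (cs.simple '' J) ↔
      ∃ ω : List B, (∀ i ∈ ω, i ∈ J) ∧ cs.wordProd ω = w := by
  constructor
  · intro hw
    induction hw using Subgroup.closure_induction with
    | mem x hx =>
      obtain ⟨i, hi, rfl⟩ := hx
      exact ⟨[i], by simpa using hi, by simp⟩
    | one => exact ⟨[], by simp, by simp⟩
    | mul x y _ _ hx hy =>
      obtain ⟨ω, hω, rfl⟩ := hx
      obtain ⟨ω', hω', rfl⟩ := hy
      refine ⟨ω ++ ω', fun i hi ↦ ?_, cs.wordProd_append ω ω'⟩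
      exact (List.mem_append.mp hi).elim (hω i) (hω' i)
    | inv x _ hx =>
      obtain ⟨ω, hω, rfl⟩ := hx
      exact ⟨ω.reverse, by simpa using hω, by simp⟩
  · rintro ⟨ω, hω, rfl⟩
    refine Subgroup.list_prod_mem _ fun x hx ↦ ?_
    obtain ⟨i, hi, rfl⟩ := List.mem_map.mp hx
    exact Subgroup.subset_closure ⟨i, hω i hi, rfl⟩

/-- Every element of the double coset `W_J d W_{J'}` of an element `d` of minimal length is a
length-additive product `a * d * c`. -/
theorem exists_length_add_of_minimal (J J' : Set B) {d : W}
    (hd : ∀ a ∈ Subgroup.closure (cs.simple '' J), ∀ c ∈ Subgroup.closure (cs.simple '' J'),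
      cs.length d ≤ cs.length (a * d * c))
    {a c : W} (ha : a ∈ Subgroup.closure (cs.simple '' J))
    (hc : c ∈ Subgroup.closure (cs.simple '' J')) :
    ∃ a' ∈ Subgroup.closure (cs.simple '' J), ∃ c' ∈ Subgroup.closure (cs.simple '' J'),
      a * d * c = a' * d * c' ∧
        cs.length (a * d * c) = cs.length a' + cs.length d + cs.length c' := by
  obtain ⟨α, hα, rfl⟩ := (cs.mem_closure_simple_image_iff J a).mp ha
  obtain ⟨γ, hγ, rfl⟩ := (cs.mem_closure_simple_image_iff J' c).mp hc
  obtain ⟨δ, hδ, rfl⟩ := cs.exists_isReduced d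
  obtain ⟨ω, hsub, hred, hprod⟩ := cs.exists_isReduced_sublist (α ++ δ ++ γ)
  obtain ⟨ω₁, γ', rfl, hsub₁, hγ'⟩ := List.sublist_append_iff.mp hsub
  obtain ⟨α', δ', rfl, hα', hδ'⟩ := List.sublist_append_iff.mp hsub₁
  simp only [wordProd_append] at hprod
  have hα'J : cs.wordProd α' ∈ Subgroup.closure (cs.simple '' J) :=
    (cs.mem_closure_simple_image_iff J _).mpr ⟨α', fun i hi ↦ hα i (hα'.subset hi), rfl⟩
  have hγ'J : cs.wordProd γ' ∈ Subgroup.closure (cs.simple '' J') :=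
    (cs.mem_closure_simple_image_iff J' _).mpr ⟨γ', fun i hi ↦ hγ i (hγ'.subset hi), rfl⟩
  have hmin := hd _ (mul_mem (inv_mem hα'J) ha) _ (mul_mem hc (inv_mem hγ'J))
  have hδeq : (cs.wordProd α')⁻¹ * cs.wordProd α * cs.wordProd δ *
      (cs.wordProd γ * (cs.wordProd γ')⁻¹) = cs.wordProd δ' := by
    calc _ = (cs.wordProd α')⁻¹ * (cs.wordProd α * cs.wordProd δ * cs.wordProd γ) *
          (cs.wordProd γ')⁻¹ := by group
      _ = _ := by rw [← hprod]; group
  rw [hδeq, hδ.eq] at hmin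
  obtain rfl := hδ'.eq_of_length_le (hmin.trans (cs.length_wordProd_le δ'))
  refine ⟨_, hα'J, _, hγ'J, hprod.symm, ?_⟩
  have h₁ := hred.eq
  simp only [wordProd_append, List.length_append] at h₁
  rw [hprod] at h₁
  have h₂ := cs.length_wordProd_le α'
  have h₃ := cs.length_wordProd_le γ'
  have h₄ := cs.length_mul_le (cs.wordProd α' * cs.wordProd δ') (cs.wordProd γ')
  have h₅ := cs.length_mul_le (cs.wordProd α') (cs.wordProd δ')
  rw [hprod] at h₄
  have h₆ := hδ.eq
  lia

theorem map_wordProd {f : W →* W} {g : B → B} (hg : ∀ i, f (cs.simple i) = cs.simple (g i))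
    (ω : List B) : f (cs.wordProd ω) = cs.wordProd (ω.map g) := by
  induction ω with
  | nil => simp
  | cons i ω ih => simp [wordProd_cons, ih, hg]

theorem length_map_le {f : W →* W} (hf : ∀ i, ∃ j, f (cs.simple i) = cs.simple j) (w : W) :
    cs.length (f w) ≤ cs.length w := by
  choose g hg using hf
  obtain ⟨ω, hω, rfl⟩ := cs.exists_isReduced w
  rw [cs.map_wordProd hg, hω.eq]
  simpa using cs.length_wordProd_le (ω.map g)

/-- An automorphism mapping simple reflections to simple reflections preserves the length. -/
theorem length_map_mulEquiv (f : W ≃* W) (hf : ∀ i, ∃ j, f (cs.simple i) = cs.simple j) (w : W) :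
    cs.length (f w) = cs.length w := by
  have hsymm : ∀ j, ∃ i, f.symm (cs.simple j) = cs.simple i := by
    choose g hg using hf
    intro j
    obtain ⟨ω, hω⟩ := cs.wordProd_surjective (f.symm (cs.simple j))
    have h₁ : cs.wordProd (ω.map g) = cs.simple j := by
      rw [← cs.map_wordProd (f := f.toMonoidHom) hg, hω]
      simp
    obtain ⟨ω', hsub, hred, hprod⟩ := cs.exists_isReduced_sublist (ω.map g)
    have hlen := hred.eq
    rw [hprod, h₁, length_simple] at hlen
    obtain ⟨k, rfl⟩ := List.length_eq_one_iff.mp hlen.symm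
    have hk : k ∈ ω.map g := hsub.subset (by simp)
    obtain ⟨i, -, rfl⟩ := List.mem_map.mp hk
    refine ⟨i, ?_⟩
    rw [MulEquiv.symm_apply_eq, hg, ← h₁, ← hprod, wordProd_singleton]
  refine le_antisymm (cs.length_map_le (f := f.toMonoidHom) hf w) ?_
  simpa using cs.length_map_le (f := f.symm.toMonoidHom) hsymm (f w)

end CoxeterSystem

namespace HR

variable {G : Type*} [Group G]

/-- `L` is additive along the double cosets of `K` and `K'`: each element of the double coset of
an element `d` minimizing `L` there is a product `a * d * c` along which `L` adds up. -/
def AdditiveOnDoubleCosets (L : G → ℕ) (K K' : Subgroup G) : Prop :=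
  ∀ d : G, (∀ a ∈ K, ∀ c ∈ K', L d ≤ L (a * d * c)) → ∀ a ∈ K, ∀ c ∈ K',
    ∃ a' ∈ K, ∃ c' ∈ K', a * d * c = a' * d * c' ∧ L (a * d * c) = L a' + L d + L c'

/-- Every double coset has an element minimizing `L`. -/
theorem exists_minimal (L : G → ℕ) (K K' : Subgroup G) (x : G) :
    ∃ d : G, (∃ a ∈ K, ∃ c ∈ K', x = a * d * c) ∧ ∀ a ∈ K, ∀ c ∈ K', L d ≤ L (a * d * c) := by
  let p : Set G := {d | ∃ a ∈ K, ∃ c ∈ K', x = a * d * c}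
  have hp : p.Nonempty := ⟨x, 1, K.one_mem, 1, K'.one_mem, by simp⟩
  refine ⟨Function.argminOn L p hp, Function.argminOn_mem L p hp, fun a ha c hc ↦ ?_⟩
  refine Function.argminOn_le L p ?_
  obtain ⟨a', ha', c', hc', h⟩ := Function.argminOn_mem L p hp
  exact ⟨a' * a⁻¹, mul_mem ha' (inv_mem ha), c⁻¹ * c', mul_mem (inv_mem hc) hc',
    h.trans (by group)⟩

variable {L : G → ℕ} {K K' : Subgroup G} {σ : G ≃* G}

/-- An automorphism preserving `L` fixes the minimizing element of a stable double coset. -/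
theorem map_eq_self_of_minimal (hLK : ∀ g ∈ K, L g = 0 → g = 1)
    (hLK' : ∀ g ∈ K', L g = 0 → g = 1) (hLσ : ∀ g, L (σ g) = L g)
    (hadd : AdditiveOnDoubleCosets L K K') {d : G}
    (hd : ∀ a ∈ K, ∀ c ∈ K', L d ≤ L (a * d * c))
    (hσd : ∃ a ∈ K, ∃ c ∈ K', σ d = a * d * c) : σ d = d := by
  obtain ⟨a, ha, c, hc, h⟩ := hσd
  obtain ⟨a', ha', c', hc', h', hL⟩ := hadd d hd a ha c hc
  rw [← h, hLσ] at hL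
  rw [h, h', hLK a' ha' (by lia), hLK' c' hc' (by lia)]
  simp

/-- A fixed element of the double coset of a fixed minimizing element `d` is `a * d * c` with `a`
and `c` fixed. -/
theorem exists_fixed_factors
    (hLK' : ∀ g ∈ K', L g = 0 → g = 1) (hLσ : ∀ g, L (σ g) = L g)
    (hLmul : ∀ g h, L (g * h) ≤ L g + L h)
    (hadd : AdditiveOnDoubleCosets L K K') (hadd' : AdditiveOnDoubleCosets L ⊥ K')
    (hK' : ∀ x ∈ K', σ x ∈ K') {d x : G} (hσd : σ d = d)
    (hd : ∀ a ∈ K, ∀ c ∈ K', L d ≤ L (a * d * c)) (hσx : σ x = x)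
    (hx : ∃ a ∈ K, ∃ c ∈ K', x = a * d * c) :
    ∃ a ∈ K, σ a = a ∧ ∃ c ∈ K', σ c = c ∧ x = a * d * c := by
  obtain ⟨u, ⟨b₀, hb₀, b, hb, hxu⟩, hu⟩ := exists_minimal L ⊥ K' x
  obtain rfl := Subgroup.mem_bot.mp hb₀
  rw [one_mul] at hxu
  have hσu : σ u = u := by
    refine map_eq_self_of_minimal (K := ⊥) (fun g hg _ ↦ Subgroup.mem_bot.mp hg) hLK' hLσ hadd' hu
      ⟨1, one_mem _, b * (σ b)⁻¹, mul_mem hb (inv_mem (hK' b hb)), ?_⟩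
    rw [one_mul, ← mul_assoc, ← hxu, eq_mul_inv_iff_mul_eq, ← map_mul, ← hxu, hσx]
  have hσb : σ b = b := by
    have h := hσx
    rw [hxu, map_mul, hσu] at h
    exact mul_left_cancel h
  obtain ⟨a, ha, c, hc, h⟩ := hx
  have huadc : u = a * d * (c * b⁻¹) := by
    rw [← mul_assoc, ← h, hxu]
    group
  obtain ⟨a', ha', c', hc', h', hL⟩ := hadd d hd a ha _ (mul_mem hc (inv_mem hb))
  rw [← huadc] at h' hL
  have hmin := hu 1 (one_mem _) c'⁻¹ (inv_mem hc')
  rw [h', one_mul, mul_inv_cancel_right, ← h'] at hmin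
  have hle := hLmul a' d
  obtain rfl := hLK' c' hc' (by lia)
  rw [mul_one] at h'
  refine ⟨a', ha', ?_, b, hb, hσb, by rw [hxu, h']⟩
  have hσa := hσu
  rw [h', map_mul, hσd] at hσa
  exact mul_right_cancel hσa

theorem dcMap_injective_and_range (hLK : ∀ g ∈ K, L g = 0 → g = 1)
    (hLK' : ∀ g ∈ K', L g = 0 → g = 1) (hLσ : ∀ g, L (σ g) = L g)
    (hLmul : ∀ g h, L (g * h) ≤ L g + L h)
    (hadd : AdditiveOnDoubleCosets L K K') (hadd' : AdditiveOnDoubleCosets L ⊥ K')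
    (hK : ∀ x ∈ K, σ x ∈ K) (hK' : ∀ x ∈ K', σ x ∈ K') :
    Function.Injective (dcMap σ K K') ∧
      Set.range (dcMap σ K K') =
        {q | ∀ x : G, Quotient.mk (dcSetoid K K') x = q →
          Quotient.mk (dcSetoid K K') (σ x) = q} := by
  refine ⟨?_, Set.Subset.antisymm ?_ ?_⟩
  · rintro ⟨x, hσx⟩ ⟨y, hσy⟩ hxy
    obtain ⟨k, hk, k', hk', hy : y = k * x * k'⟩ := Quotient.exact hxy
    obtain ⟨d, ⟨a, ha, c, hc, hx⟩, hd⟩ := exists_minimal L K K' x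
    have hσd : σ d = d := by
      refine map_eq_self_of_minimal hLK hLK' hLσ hadd hd
        ⟨(σ a)⁻¹ * a, mul_mem (inv_mem (hK a ha)) ha, c * (σ c)⁻¹,
          mul_mem hc (inv_mem (hK' c hc)), ?_⟩
      calc σ d = (σ a)⁻¹ * σ (a * d * c) * (σ c)⁻¹ := by simp only [map_mul]; group
        _ = (σ a)⁻¹ * (a * d * c) * (σ c)⁻¹ := by rw [← hx, hσx]
        _ = _ := by group
    obtain ⟨a₁, ha₁, hσa₁, c₁, hc₁, hσc₁, hx₁⟩ := exists_fixed_factors hLK' hLσ hLmul hadd hadd'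
      hK' hσd hd hσx ⟨a, ha, c, hc, hx⟩
    obtain ⟨a₂, ha₂, hσa₂, c₂, hc₂, hσc₂, hy₂⟩ := exists_fixed_factors hLK' hLσ hLmul hadd hadd'
      hK' hσd hd hσy ⟨k * a, mul_mem hk ha, c * k', mul_mem hc hk', by rw [hy, hx]; group⟩
    refine Quotient.sound ⟨a₂ * a₁⁻¹, by simp [hσa₁, hσa₂], mul_mem ha₂ (inv_mem ha₁), c₁⁻¹ * c₂,
      by simp [hσc₁, hσc₂], mul_mem (inv_mem hc₁) hc₂, ?_⟩
    change y = a₂ * a₁⁻¹ * x * (c₁⁻¹ * c₂)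
    rw [hy₂, hx₁]
    group
  · rintro _ ⟨⟨y, hσy⟩, rfl⟩ x hx
    obtain ⟨k, hk, k', hk', hy : y = k * x * k'⟩ := Quotient.exact hx
    refine Quotient.sound ⟨σ k, hK k hk, σ k', hK' k' hk', ?_⟩
    change y = _
    rw [← map_mul, ← map_mul, ← hy, hσy]
  · intro q hq
    obtain ⟨x, rfl⟩ := Quotient.exists_rep q
    obtain ⟨d, ⟨a, ha, c, hc, hx⟩, hd⟩ := exists_minimal L K K' x
    have hdx : Quotient.mk (dcSetoid K K') d = Quotient.mk (dcSetoid K K') x :=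
      Quotient.sound ⟨a, ha, c, hc, hx⟩
    obtain ⟨k, hk, k', hk', hσd⟩ := Quotient.exact (hdx.trans (hq d hdx).symm)
    exact ⟨Quotient.mk _ ⟨d, map_eq_self_of_minimal hLK hLK' hLσ hadd hd ⟨k, hk, k', hk', hσd⟩⟩,
      hdx⟩

section SemidirectProduct

variable {B W : Type*} [Group W] {M : CoxeterMatrix B} (cs : CoxeterSystem M W)
  {Ω : Type*} [Group Ω] {φ : Ω →* MulAut W}

/-- The length function of `W ⋊ Ω` is additive along double cosets of standard parabolic
subgroups. -/
theorem additiveOnDoubleCosets_length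
    (hperm : ∀ (ω : Ω) (i : B), ∃ j : B, φ ω (cs.simple i) = cs.simple j) (J J' : Set B) :
    AdditiveOnDoubleCosets (fun x : W ⋊[φ] Ω ↦ cs.length x.left)
      ((Subgroup.closure (cs.simple '' J)).map SemidirectProduct.inl)
      ((Subgroup.closure (cs.simple '' J')).map SemidirectProduct.inl) := by
  rintro ⟨w, ω⟩ hd _ ⟨a, ha, rfl⟩ _ ⟨c, hc, rfl⟩
  choose g hg using hperm ω
  have himage : cs.simple '' (g '' J') = (φ ω).toMonoidHom '' (cs.simple '' J') := by
    rw [Set.image_image, Set.image_image]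
    exact Set.image_congr fun i _ ↦ (hg i).symm
  have hmap : Subgroup.closure (cs.simple '' (g '' J')) =
      (Subgroup.closure (cs.simple '' J')).map (φ ω).toMonoidHom := by
    rw [MonoidHom.map_closure, himage]
  have hlen := cs.length_map_mulEquiv (φ ω) (hperm ω)
  have hmul : ∀ a c : W, (SemidirectProduct.inl a * ⟨w, ω⟩ * SemidirectProduct.inl c : W ⋊[φ] Ω) =
      ⟨a * w * φ ω c, ω⟩ := fun a c ↦ by ext <;> simp
  have hmin : ∀ a ∈ Subgroup.closure (cs.simple '' J),
      ∀ c ∈ Subgroup.closure (cs.simple '' (g '' J')),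
      cs.length w ≤ cs.length (a * w * c) := by
    intro a ha c hc
    rw [hmap] at hc
    obtain ⟨c, hc, rfl⟩ := hc
    have h := hd _ ⟨a, ha, rfl⟩ _ ⟨c, hc, rfl⟩
    rw [hmul] at h
    exact h
  obtain ⟨a', ha', c', hc', h, hL⟩ := cs.exists_length_add_of_minimal J (g '' J') hmin ha
    (c := φ ω c) (hmap ▸ ⟨c, hc, rfl⟩)
  rw [hmap] at hc'
  obtain ⟨c', hc', rfl⟩ := hc'
  refine ⟨_, ⟨a', ha', rfl⟩, _, ⟨c', hc', rfl⟩, ?_, ?_⟩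
  · rw [hmul, hmul, h]
    rfl
  · rw [hmul]
    simpa [hlen] using hL

/-- An automorphism of `W ⋊ Ω` preserving `W`, `Ω` and the simple reflections preserves the
length. -/
theorem length_left_map (σ : (W ⋊[φ] Ω) ≃* (W ⋊[φ] Ω))
    (hσW : ∀ w : W, ∃ w' : W, σ (SemidirectProduct.inl w) = SemidirectProduct.inl w')
    (hσS : ∀ i : B, ∃ j : B, σ (SemidirectProduct.inl (cs.simple i)) =
      SemidirectProduct.inl (cs.simple j))
    (hσΩ : ∀ ω : Ω, ∃ ω' : Ω, σ (SemidirectProduct.inr ω) = SemidirectProduct.inr ω')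
    (x : W ⋊[φ] Ω) : cs.length (σ x).left = cs.length x.left := by
  choose f hf using hσW
  choose g hg using hσΩ
  have hσ : ∀ x : W ⋊[φ] Ω,
      σ x = SemidirectProduct.inl (f x.left) * SemidirectProduct.inr (g x.right) := by
    intro x
    rw [← hf, ← hg, ← map_mul, SemidirectProduct.inl_left_mul_inr_right]
  let F : W →* W := MonoidHom.mk' f fun a b ↦ by
    apply SemidirectProduct.inl_injective (φ := φ)
    rw [← hf, map_mul, map_mul, hf, hf, map_mul]
  have hbij : Function.Bijective F := by
    constructor
    · intro a b hab
      apply SemidirectProduct.inl_injective (φ := φ)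
      apply σ.injective
      rw [hf, hf]
      exact congrArg _ hab
    · intro w
      refine ⟨(σ.symm (SemidirectProduct.inl w)).left, ?_⟩
      have h := congrArg SemidirectProduct.left (hσ (σ.symm (SemidirectProduct.inl w)))
      simpa [F] using h.symm
  have h := cs.length_map_mulEquiv (MulEquiv.ofBijective F hbij) (fun i ↦ ?_) x.left
  · rw [hσ]
    simpa [F] using h
  · obtain ⟨j, hj⟩ := hσS i
    refine ⟨j, SemidirectProduct.inl_injective (φ := φ) ?_⟩
    rw [← hj, hf]
    rfl

theorem length_left_mul_le
    (hperm : ∀ (ω : Ω) (i : B), ∃ j : B, φ ω (cs.simple i) = cs.simple j) (x y : W ⋊[φ] Ω) :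
    cs.length (x * y).left ≤ cs.length x.left + cs.length y.left := by
  rw [SemidirectProduct.mul_left, ← cs.length_map_mulEquiv (φ x.right) (hperm x.right) y.left]
  exact cs.length_mul_le _ _

theorem eq_one_of_length_left_eq_zero {P : Subgroup W} (x : W ⋊[φ] Ω)
    (hx : x ∈ P.map (SemidirectProduct.inl : W →* W ⋊[φ] Ω)) (h : cs.length x.left = 0) :
    x = 1 := by
  obtain ⟨w, -, rfl⟩ := hx
  rw [SemidirectProduct.left_inl, cs.length_eq_zero_iff] at h
  rw [h, map_one]

end SemidirectProduct

end HR

/-- Let `(W, S)` be a Coxeter system, `Ω` acting on `W`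
preserving `S`, `W̃ = W ⋊ Ω`, and `σ` an automorphism of `W̃` preserving `W`,
`S` and `Ω`.  For `σ`-stable standard parabolic subgroups `W^K = ⟨J⟩`,
`W^{K'} = ⟨J'⟩` of `W`, the natural map
`(W^K)^σ \ W̃^σ / (W^{K'})^σ → [W^K \ W̃ / W^{K'}]^σ` is bijective. -/
theorem statement3 {B : Type*} {W : Type*} [Group W] {M : CoxeterMatrix B}
    (cs : CoxeterSystem M W) {Ω : Type*} [Group Ω] (φ : Ω →* MulAut W)
    (hperm : ∀ (ω : Ω) (i : B), ∃ j : B, φ ω (cs.simple i) = cs.simple j)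
    (σ : (W ⋊[φ] Ω) ≃* (W ⋊[φ] Ω))
    (hσWa : ∀ w : W, ∃ w' : W, σ (SemidirectProduct.inl w) = SemidirectProduct.inl w')
    (hσS : ∀ i : B, ∃ j : B, σ (SemidirectProduct.inl (cs.simple i)) =
      SemidirectProduct.inl (cs.simple j))
    (hσΩ : ∀ ω : Ω, ∃ ω' : Ω, σ (SemidirectProduct.inr ω) = SemidirectProduct.inr ω')
    (J J' : Set B)
    (hJσ : ∀ x ∈ (Subgroup.closure (cs.simple '' J)).map
      (SemidirectProduct.inl : W →* W ⋊[φ] Ω),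
      σ x ∈ (Subgroup.closure (cs.simple '' J)).map
        (SemidirectProduct.inl : W →* W ⋊[φ] Ω))
    (hJ'σ : ∀ x ∈ (Subgroup.closure (cs.simple '' J')).map
      (SemidirectProduct.inl : W →* W ⋊[φ] Ω),
      σ x ∈ (Subgroup.closure (cs.simple '' J')).map
        (SemidirectProduct.inl : W →* W ⋊[φ] Ω)) :
    Function.Injective (HR.dcMap σ
      ((Subgroup.closure (cs.simple '' J)).map (SemidirectProduct.inl : W →* W ⋊[φ] Ω))
      ((Subgroup.closure (cs.simple '' J')).map (SemidirectProduct.inl : W →* W ⋊[φ] Ω))) ∧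
    Set.range (HR.dcMap σ
      ((Subgroup.closure (cs.simple '' J)).map (SemidirectProduct.inl : W →* W ⋊[φ] Ω))
      ((Subgroup.closure (cs.simple '' J')).map (SemidirectProduct.inl : W →* W ⋊[φ] Ω))) =
      {q | ∀ x : W ⋊[φ] Ω,
        Quotient.mk (HR.dcSetoid
          ((Subgroup.closure (cs.simple '' J)).map (SemidirectProduct.inl : W →* W ⋊[φ] Ω))
          ((Subgroup.closure (cs.simple '' J')).map (SemidirectProduct.inl : W →* W ⋊[φ] Ω))) x
            = q →
        Quotient.mk (HR.dcSetoid
          ((Subgroup.closure (cs.simple '' J)).map (SemidirectProduct.inl : W →* W ⋊[φ] Ω))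
          ((Subgroup.closure (cs.simple '' J')).map (SemidirectProduct.inl : W →* W ⋊[φ] Ω)))
            (σ x) = q} := by
  refine HR.dcMap_injective_and_range (L := fun x ↦ cs.length x.left)
    (HR.eq_one_of_length_left_eq_zero cs) (HR.eq_one_of_length_left_eq_zero cs)
    (HR.length_left_map cs σ hσWa hσS hσΩ) (HR.length_left_mul_le cs hperm)
    (HR.additiveOnDoubleCosets_length cs hperm J J') ?_ hJσ hJ'σ
  simpa using HR.additiveOnDoubleCosets_length cs hperm ∅ J'
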